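/- Let K/F be cyclic Galois of degree n with Gal(K/F)=⟨σ⟩ and suppose τ ∈ Aut(K) with τστ⁻¹=σ^k, k ∈ {2,…,n−1}, gcd(k,n)=1. If G_{τ,α,k} : K[t;σ]/(t^m−a) → K[t;σ]/(t^m−b) given by Σ c_i t^i ↦ Σ τ(c_i)(α t^k)^i is a ring isomorphism, then n divides m, a and b lie in F×, gcd(k,m)=1, and (N_{K/F}(α))^{m/n} b^k = τ(a). -/

import Mathlib

/-- Twisted norm `N_i^σ(α) = σ^{i-1}(α) ⋯ σ(α) α`. -/
noncomputable def twistedNorm {K : Type*} [Field K] (σ : K → K) (i : ℕ) (α : K) : K :=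
  ∏ j ∈ Finset.range i, σ^[j] α

/-- Multiplication of the Petit algebra `K[t;σ]/K[t;σ](t^m − a)` in the coordinates of
the basis `1, t, …, t^{m-1}`. -/
noncomputable def petitMul {K : Type*} [Field K] (σ : K ≃+* K) (m : ℕ) (a : K)
    (f g : Fin m → K) : Fin m → K :=
  fun r => ∑ i : Fin m, ∑ j : Fin m,
    if (i : ℕ) + (j : ℕ) = (r : ℕ) then f i * (⇑σ)^[(i : ℕ)] (g j)
    else if (i : ℕ) + (j : ℕ) = (r : ℕ) + m then
      f i * (⇑σ)^[(i : ℕ)] (g j) * (⇑σ)^[(r : ℕ)] a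
    else 0

/-- The canonical copy of `c ∈ K` inside the Petit algebra. -/
noncomputable def petitScalar {K : Type*} [Field K] (m : ℕ) (c : K) : Fin m → K :=
  fun i => if (i : ℕ) = 0 then c else 0

/-- The image of `t^k` in `K[t;σ]/K[t;σ](t^m − b)`: writing `k = qm + r` with
`0 ≤ r < m`, `t^k` reduces to `(∏_{i=1}^{q} σ^{k−im}(b)) t^r`. -/
noncomputable def petitTPow {K : Type*} [Field K] (σ : K ≃+* K) (m : ℕ) (b : K)
    (k : ℕ) : Fin m → K :=
  fun r => if (r : ℕ) = k % m then ∏ i ∈ Finset.Icc 1 (k / m), (⇑σ)^[k - i * m] b else 0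

/-- The monomial `c t^i`. -/
noncomputable def petitT {K : Type*} [Field K] (m i : ℕ) (c : K) : Fin m → K :=
  fun r => if (r : ℕ) = i then c else 0

/-- Reduction coefficient. -/
noncomputable def petitW {K : Type*} [Field K] (σ : K ≃+* K) (m : ℕ) (b : K) (s : ℕ) : K :=
  if s < m then 1 else (σ ^ (s - m)) b

theorem petit_iter {K : Type*} [Field K] (σ : K ≃+* K) (i : ℕ) (x : K) :
    (⇑σ)^[i] x = (σ ^ i) x := by
  induction i generalizing x with
  | zero => rfl
  | succ i ih => rw [Function.iterate_succ_apply, ih, pow_succ]; rfl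

theorem petit_pow_add {K : Type*} [Field K] (σ : K ≃+* K) (i j : ℕ) (x : K) :
    (σ ^ (i + j)) x = (σ ^ i) ((σ ^ j) x) := by
  rw [pow_add]; rfl

theorem petit_ne {K : Type*} [Field K] (σ : K ≃+* K) (i : ℕ) {x : K} (hx : x ≠ 0) :
    (σ ^ i) x ≠ 0 := fun h => hx ((σ ^ i).injective (h.trans (map_zero (σ ^ i)).symm))

theorem petitMul_T {K : Type*} [Field K] (σ : K ≃+* K) (m : ℕ) (b : K) (i j : ℕ)
    (hi : i < m) (hj : j < m) (c d : K) :
    petitMul σ m b (petitT m i c) (petitT m j d)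
      = petitT m ((i + j) % m) (c * (σ ^ i) d * petitW σ m b (i + j)) := by
  funext r
  unfold petitMul
  rw [Finset.sum_eq_single (⟨i, hi⟩ : Fin m), Finset.sum_eq_single (⟨j, hj⟩ : Fin m)]
  · simp only [petit_iter, petitT, petitW, if_true]
    have hr := r.2
    by_cases h : i + j < m
    · rw [Nat.mod_eq_of_lt h, if_pos h]
      by_cases h1 : i + j = r
      · simp [h1]
      · have h2 : ¬ (i + j = r + m) := by omega
        have h3 : ¬ ((r : ℕ) = i + j) := by omega
        simp [h1, h2, h3]
    · have h0 : (i + j) % m = i + j - m := by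
        rw [Nat.mod_eq_sub_mod (by omega), Nat.mod_eq_of_lt (by omega)]
      rw [h0, if_neg h]
      have h1 : ¬ (i + j = r) := by omega
      by_cases h2 : i + j = r + m
      · have h3 : (r : ℕ) = i + j - m := by omega
        rw [if_neg h1, if_pos h2, if_pos h3, ← h3]
      · have h3 : ¬ ((r : ℕ) = i + j - m) := by omega
        rw [if_neg h1, if_neg h2, if_neg h3]
  · intro x _ hx
    have : ¬ ((x : ℕ) = j) := fun h => hx (Fin.ext h)
    simp only [petitT, this, petit_iter, if_false, map_zero, mul_zero, zero_mul, ite_self]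
  · simp
  · intro x _ hx
    have : ¬ ((x : ℕ) = i) := fun h => hx (Fin.ext h)
    simp [petitT, this]
  · simp

theorem petitT_inj {K : Type*} [Field K] {m i j : ℕ} (hi : i < m) {c d : K} (hc : c ≠ 0)
    (h : petitT m i c = petitT m j d) : i = j ∧ c = d := by
  have := congrFun h ⟨i, hi⟩
  simp only [petitT, if_true] at this
  by_cases hij : i = j
  · simp [hij] at this; exact ⟨hij, this⟩
  · simp [hij] at this; exact absurd this hc

/-- `∏_{j<i} σ^{kj} α`. -/
noncomputable def petitN {K : Type*} [Field K] (σ : K ≃+* K) (k : ℕ) (α : K) (i : ℕ) : K :=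
  ∏ j ∈ Finset.range i, (σ ^ (k * j)) α

theorem petitN_succ {K : Type*} [Field K] (σ : K ≃+* K) (k : ℕ) (α : K) (i : ℕ) :
    petitN σ k α (i + 1) = petitN σ k α i * (σ ^ (k * i)) α := by
  simp [petitN, Finset.prod_range_succ]

theorem petitN_succ' {K : Type*} [Field K] (σ : K ≃+* K) (k : ℕ) (α : K) (i : ℕ) :
    petitN σ k α (i + 1) = α * (σ ^ k) (petitN σ k α i) := by
  simp only [petitN]
  rw [Finset.prod_range_succ', map_prod, mul_comm]
  congr 1
  refine Finset.prod_congr rfl fun j _ => ?_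
  rw [← petit_pow_add]; congr 2; ring

theorem petitN_ne {K : Type*} [Field K] (σ : K ≃+* K) (k : ℕ) (α : K) (hα : α ≠ 0) (i : ℕ) :
    petitN σ k α i ≠ 0 := by
  rw [petitN, Finset.prod_ne_zero_iff]
  intro j _
  exact petit_ne σ _ hα

theorem petit_pow_mod {K : Type*} [Field K] (σ : K ≃+* K) (n : ℕ) (h : σ ^ n = 1) (i : ℕ) :
    σ ^ (i % n) = σ ^ i := by
  conv_rhs => rw [← Nat.mod_add_div i n, pow_add, pow_mul, h, one_pow, mul_one]

theorem petitN_n {K : Type*} [Field K] (σ : K ≃+* K) (n k : ℕ) (hn : 0 < n) (α : K)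
    (h : σ ^ n = 1) (hcop : Nat.Coprime k n) :
    petitN σ k α n = twistedNorm (⇑σ) n α := by
  unfold petitN twistedNorm
  have hmaps : Set.MapsTo (fun j => k * j % n) (Finset.range n : Set ℕ)
      (Finset.range n : Set ℕ) := by
    intro j _
    simpa using Nat.mod_lt _ hn
  have hinj : Set.InjOn (fun j => k * j % n) (Finset.range n : Set ℕ) := by
    intro x hx y hy hxy
    have h1 : k * x ≡ k * y [MOD n] := hxy
    have h2 : x ≡ y [MOD n] := Nat.ModEq.cancel_left_of_coprime (Nat.Coprime.symm hcop) h1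
    simp at hx hy
    exact Nat.ModEq.eq_of_lt_of_lt h2 hx hy
  refine Finset.prod_nbij (fun j => k * j % n) hmaps hinj
    (Finset.surjOn_of_injOn_of_card_le _ hmaps hinj le_rfl) ?_
  intro j _
  rw [petit_iter, petit_pow_mod σ n h]

theorem petitN_mul {K : Type*} [Field K] (σ : K ≃+* K) (n k : ℕ) (α : K)
    (h : σ ^ n = 1) (q : ℕ) :
    petitN σ k α (n * q) = petitN σ k α n ^ q := by
  induction q with
  | zero => simp [petitN]
  | succ q ih =>
    rw [pow_succ, ← ih, Nat.mul_succ]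
    simp only [petitN]
    rw [Finset.prod_range_add]
    congr 1
    refine Finset.prod_congr rfl fun j _ => ?_
    rw [← petit_pow_mod σ n h (k * (n * q + j)), ← petit_pow_mod σ n h (k * j)]
    congr 2
    rw [show k * (n * q + j) = k * j + n * (k * q) by ring, Nat.add_mul_mod_self_left]

theorem twistedNorm_fix {K : Type*} [Field K] (σ : K ≃+* K) (n : ℕ) (α : K)
    (h : σ ^ n = 1) : σ (twistedNorm (⇑σ) n α) = twistedNorm (⇑σ) n α := by
  unfold twistedNorm
  by_cases hα : α = 0
  · subst hα
    rcases n with _ | n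
    · simp
    · simp [Finset.prod_const]
  · have h1 := Finset.prod_range_succ (fun j => (⇑σ)^[j] α) n
    have h2 := Finset.prod_range_succ' (fun j => (⇑σ)^[j] α) n
    rw [h1] at h2
    rw [petit_iter σ n, h] at h2
    have h3 : (∏ x ∈ Finset.range n, (⇑σ)^[x] α) * α
        = (∏ x ∈ Finset.range n, (⇑σ)^[x + 1] α) * α := h2
    have h4 := mul_right_cancel₀ hα h3
    rw [map_prod, h4]
    refine Finset.prod_congr rfl fun j _ => ?_
    rw [Function.iterate_succ_apply']

theorem petit_fix_of_pow {K : Type*} [Field K] (σ : K ≃+* K) (n k : ℕ)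
    (h : σ ^ n = 1) (hcop : Nat.Coprime k n) (hn : 1 < n) (b : K) (hb : (σ ^ k) b = b) :
    σ b = b := by
  obtain ⟨l, hl⟩ := Nat.exists_mul_mod_eq_one_of_coprime hcop hn
  have h1 : ∀ l, (σ ^ (k * l)) b = b := by
    intro l
    induction l with
    | zero => simp
    | succ l ih => rw [Nat.mul_succ, petit_pow_add, hb, ih]
  have h2 := h1 l
  rw [← petit_pow_mod σ n h, hl.2, pow_one] at h2
  exact h2

/-- Let `K/F` be cyclic Galois of degree `n` with `Gal(K/F)=⟨σ⟩` and let
`τ ∈ Aut(K)` satisfy `τστ⁻¹ = σ^k`, `k ∈ {2,…,n−1}`, `gcd(k,n) = 1`.  If the monomial map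
`G_{τ,α,k} : K[t;σ]/(t^m−a) → K[t;σ]/(t^m−b)` extending `τ` and sending `t ↦ α t^k` is a
ring isomorphism, then `n ∣ m`, `a, b ∈ F×` (i.e. are fixed by `σ`), `gcd(k,m) = 1`, and
`(N_{K/F}(α))^{m/n}·b^k = τ(a)`. -/
theorem stmt10 {K : Type*} [Field K] (n m : ℕ) (hm : 0 < m)
    (σ τ : K ≃+* K) (horder : orderOf σ = n)
    (k : ℕ) (hk2 : 2 ≤ k) (hkn : k ≤ n - 1) (hcop : Nat.Coprime k n)
    (hconj : ∀ x : K, τ (σ (τ.symm x)) = (σ ^ k) x)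
    (a b : K) (ha : a ≠ 0) (hb : b ≠ 0) (α : K) (hα : α ≠ 0)
    (G : (Fin m → K) → (Fin m → K))
    (hGbij : Function.Bijective G)
    (hGadd : ∀ x y : Fin m → K, G (x + y) = G x + G y)
    (hGmul : ∀ x y : Fin m → K, G (petitMul σ m a x y) = petitMul σ m b (G x) (G y))
    (hGτ : ∀ c : K, G (petitScalar m c) = petitScalar m (τ c))
    (hGt : G (fun i : Fin m => if (i : ℕ) = 1 then 1 else 0) =
      fun r : Fin m => α * petitTPow σ m b k r) :
    n ∣ m ∧ σ a = a ∧ σ b = b ∧ Nat.Coprime k m ∧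
      (twistedNorm (⇑σ) n α) ^ (m / n) * b ^ k = τ a := by
  have hn : σ ^ n = 1 := by rw [← horder]; exact pow_orderOf_eq_one σ
  have hn3 : 3 ≤ n := by omega
  have hT0 : ∀ c : K, G (petitT m 0 c) = petitT m 0 (τ c) := hGτ
  have hG0 : G 0 = 0 := by
    have := hGadd 0 0
    simpa using this
  have hτσ : ∀ (i : ℕ) (x : K), τ ((σ ^ i) x) = (σ ^ (k * i)) (τ x) := by
    intro i
    induction i with
    | zero => intro x; simp
    | succ i ih =>
      intro x
      have h1 := hconj (τ ((σ ^ i) x))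
      rw [RingEquiv.symm_apply_apply, ih] at h1
      rw [add_comm i 1, petit_pow_add, pow_one, h1, ← petit_pow_add]
      congr 2; ring
  set s := k % m with hs
  have hsm : s < m := Nat.mod_lt _ hm
  obtain ⟨B, hBdef⟩ : ∃ B, B = ∏ i ∈ Finset.Icc 1 (k / m), (⇑σ)^[k - i * m] b := ⟨_, rfl⟩
  have hB : B ≠ 0 := by
    rw [hBdef, Finset.prod_ne_zero_iff]
    intro i _
    rw [petit_iter]; exact petit_ne σ _ hb
  have hT1 : G (petitT m 1 1) = petitT m s (α * B) := by
    refine hGt.trans ?_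
    funext r
    simp only [petitT, petitTPow, ← hBdef, ← hs]
    split_ifs <;> simp
  have hm2 : 2 ≤ m := by
    by_contra hlt
    have h1 : m = 1 := by omega
    have h2 : petitT m 1 (1 : K) = 0 := by
      funext r
      have := r.2
      have h3 : ¬ ((r : ℕ) = 1) := by omega
      simp [petitT, h3]
    rw [h2, hG0] at hT1
    have h3 := congrFun hT1 ⟨s, hsm⟩
    simp [petitT, hα, hB] at h3
  -- commutation with scalars
  have hcomm : ∀ i l : ℕ, ∀ γ : K, i < m → l < m → γ ≠ 0 →
      G (petitT m i 1) = petitT m l γ → ∀ x : K, (σ ^ l) x = (σ ^ (k * i)) x := by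
    intro i l γ hi hl hγ hGi x
    have h1 : petitMul σ m a (petitT m i 1) (petitT m 0 (τ.symm x))
        = petitMul σ m a (petitT m 0 ((σ ^ i) (τ.symm x))) (petitT m i 1) := by
      rw [petitMul_T _ _ _ _ _ hi hm, petitMul_T _ _ _ _ _ hm hi]
      simp [petitW, hi]
    have h2 := congrArg G h1
    rw [hGmul, hGmul, hT0, hT0, hGi, hτσ, RingEquiv.apply_symm_apply,
      petitMul_T _ _ _ _ _ hl hm, petitMul_T _ _ _ _ _ hm hl] at h2
    simp only [petitW, add_zero, zero_add, hl, if_true, mul_one, pow_zero,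
      Nat.mod_eq_of_lt hl] at h2
    have h3 := congrFun h2 ⟨l, hl⟩
    simp only [petitT, if_true] at h3
    have h4 : γ * (σ ^ l) x = γ * (σ ^ (k * i)) x := by
      rw [h3, mul_comm]; rfl
    exact mul_left_cancel₀ hγ h4
  have hdvd : ∀ u v : ℕ, u ≤ v → (∀ x : K, (σ ^ u) x = (σ ^ v) x) → n ∣ v - u := by
    intro u v huv h
    have h1 : σ ^ u = σ ^ v := RingEquiv.ext h
    rw [← horder]
    apply orderOf_dvd_of_pow_eq_one
    have h2 : σ ^ u * σ ^ (v - u) = σ ^ u * 1 := by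
      rw [← pow_add, mul_one, h1]; congr 1; omega
    exact mul_left_cancel h2
  have hkm : k < m := by
    by_contra hlt
    have h1 := hdvd s k (Nat.mod_le _ _) (by
      have := hcomm 1 s _ (by omega) hsm (mul_ne_zero hα hB) hT1
      simpa using this)
    have h2 : 0 < k - s := by omega
    have h3 := Nat.le_of_dvd h2 h1
    omega
  have hsk : s = k := Nat.mod_eq_of_lt hkm
  have hB1 : B = 1 := by
    rw [hBdef, Nat.div_eq_of_lt hkm]; simp
  rw [hsk, hB1, mul_one] at hT1
  have hstep : ∀ i l : ℕ, ∀ γ : K, i + 1 < m → l < m → G (petitT m i 1) = petitT m l γ →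
      G (petitT m (i + 1) 1)
        = petitT m ((k + l) % m) (α * (σ ^ k) γ * petitW σ m b (k + l)) := by
    intro i l γ hi hl hGi
    have h1 : petitMul σ m a (petitT m 1 1) (petitT m i 1) = petitT m (i + 1) 1 := by
      rw [petitMul_T _ _ _ _ _ (by omega) (by omega)]
      simp [petitW, add_comm 1 i, hi, Nat.mod_eq_of_lt hi]
    rw [← h1, hGmul, hT1, hGi, petitMul_T _ _ _ _ _ hkm hl]
  have hWne : ∀ u, petitW σ m b u ≠ 0 := by
    intro u
    unfold petitW
    split_ifs
    · exact one_ne_zero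
    · exact petit_ne σ _ hb
  have hgen : ∀ i, i < m → ∃ γ : K, γ ≠ 0 ∧ G (petitT m i 1) = petitT m (k * i % m) γ := by
    intro i
    induction i with
    | zero => intro _; exact ⟨1, one_ne_zero, by rw [hT0]; simp⟩
    | succ i ih =>
      intro hi
      obtain ⟨γ, hγ, hGi⟩ := ih (by omega)
      refine ⟨α * (σ ^ k) γ * petitW σ m b (k + k * i % m), ?_, ?_⟩
      rotate_left
      · rw [hstep i _ γ hi (Nat.mod_lt _ hm) hGi, Nat.add_mod_mod,
          show k + k * i = k * (i + 1) by ring]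
      · exact mul_ne_zero (mul_ne_zero hα (petit_ne σ _ hγ)) (hWne _)
  have hcopm : Nat.Coprime k m := by
    by_contra hg
    have hgpos : 0 < Nat.gcd k m := Nat.gcd_pos_of_pos_right _ hm
    have hg2 : 1 < Nat.gcd k m := by
      have : Nat.gcd k m ≠ 1 := hg
      omega
    obtain ⟨j, hj⟩ := Nat.gcd_dvd_right k m
    obtain ⟨k', hk'⟩ := Nat.gcd_dvd_left k m
    have hjpos : 0 < j := by
      rcases Nat.eq_zero_or_pos j with h | h
      · rw [h] at hj; omega
      · exact h
    have hjm : j < m := by nlinarith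
    obtain ⟨γ, hγ, hGj⟩ := hgen j hjm
    have h0 : k * j % m = 0 := by
      apply Nat.mod_eq_zero_of_dvd
      refine ⟨k', ?_⟩
      calc k * j = (Nat.gcd k m * k') * j := by rw [← hk']
        _ = (Nat.gcd k m * j) * k' := by ring
        _ = m * k' := by rw [← hj]
    rw [h0] at hGj
    have h1 : G (petitT m 0 (τ.symm γ)) = G (petitT m j 1) := by
      rw [hT0, hGj, RingEquiv.apply_symm_apply]
    have h2 := petitT_inj hm (by simpa using hγ) (hGbij.1 h1)
    omega
  -- first wrap
  obtain ⟨j0, hj0⟩ : ∃ j0, j0 = (m - 1) / k := ⟨_, rfl⟩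
  have hj1 : k * j0 < m := by
    have := Nat.mul_div_le (m - 1) k
    rw [hj0]; omega
  have hj2 : m ≤ k * (j0 + 1) := by
    have := Nat.lt_mul_div_succ (m - 1) (show 0 < k by omega)
    rw [hj0]; omega
  have hj3 : j0 + 1 < m := by nlinarith
  have hlow : ∀ i, k * i < m → G (petitT m i 1) = petitT m (k * i) (petitN σ k α i) := by
    intro i
    induction i with
    | zero => intro _; rw [hT0]; simp [petitN]
    | succ i ih =>
      intro hi
      have hi' : k + k * i < m := by rw [Nat.mul_succ] at hi; omega
      have him : i + 1 < m := by nlinarith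
      rw [hstep i _ _ him (by omega) (ih (by omega)), petitN_succ', Nat.mod_eq_of_lt hi']
      simp only [petitW, hi', if_true, mul_one]
      congr 1; ring
  have hks : k * (j0 + 1) = k + k * j0 := by ring
  obtain ⟨r, hr⟩ : ∃ r, k + k * j0 = r + m := ⟨k + k * j0 - m, by omega⟩
  have hrm : r < m := by omega
  have hwrap : G (petitT m (j0 + 1) 1)
      = petitT m r (petitN σ k α (j0 + 1) * (σ ^ r) b) := by
    rw [hstep j0 _ _ hj3 hj1 (hlow j0 hj1), petitN_succ', hr, Nat.add_mod_right,
      Nat.mod_eq_of_lt hrm]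
    simp [petitW]
  have hγne : petitN σ k α (j0 + 1) * (σ ^ r) b ≠ 0 :=
    mul_ne_zero (petitN_ne σ k α hα _) (petit_ne σ _ hb)
  have hnm : n ∣ m := by
    have h1 := hdvd r (k * (j0 + 1)) (by omega) (hcomm (j0 + 1) r _ hj3 hrm hγne hwrap)
    have h2 : k * (j0 + 1) - r = m := by omega
    rwa [h2] at h1
  obtain ⟨q, hq⟩ := hnm
  have hσm : σ ^ m = 1 := by rw [hq, pow_mul, hn, one_pow]
  have hσb : σ b = b := by
    apply petit_fix_of_pow σ n k hn hcop (by omega)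
    have h1 : petitMul σ m a (petitT m (j0 + 1) 1) (petitT m 1 1)
        = petitMul σ m a (petitT m 1 1) (petitT m (j0 + 1) 1) := by
      rw [petitMul_T _ _ _ _ _ hj3 (by omega), petitMul_T _ _ _ _ _ (by omega) hj3,
        add_comm 1 (j0 + 1)]
      simp
    have h2 := congrArg G h1
    rw [hGmul, hGmul, hT1, hwrap, petitMul_T _ _ _ _ _ hrm hkm,
      petitMul_T _ _ _ _ _ hkm hrm, add_comm k r] at h2
    have h3 := (petitT_inj (Nat.mod_lt _ hm)
      (mul_ne_zero (mul_ne_zero hγne (petit_ne σ _ hα)) (hWne _)) h2).2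
    have h4 := mul_right_cancel₀ (hWne _) h3
    have h5 : σ ^ r = σ ^ (k * (j0 + 1)) := by
      rw [hks, hr, pow_add, hσm, mul_one]
    rw [map_mul, ← mul_assoc, ← petitN_succ', petitN_succ σ k α (j0 + 1), ← h5] at h4
    have h6 : (petitN σ k α (j0 + 1) * (σ ^ r) α) * (σ ^ r) b
        = (petitN σ k α (j0 + 1) * (σ ^ r) α) * (σ ^ r) ((σ ^ k) b) := by
      rw [← petit_pow_add, add_comm r k, petit_pow_add, ← h4]; ring
    have h7 := mul_left_cancel₀
      (mul_ne_zero (petitN_ne σ k α hα (j0 + 1)) (petit_ne σ _ hα)) h6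
    exact ((σ ^ r).injective h7).symm
  have hpowb : ∀ i, (σ ^ i) b = b := by
    intro i
    induction i with
    | zero => simp
    | succ i ih => rw [petit_pow_add, pow_one, hσb, ih]
  have hW : ∀ i, i < 2 * m → petitW σ m b i = b ^ (i / m) := by
    intro i hi
    unfold petitW
    split_ifs with h
    · rw [Nat.div_eq_of_lt h, pow_zero]
    · have : i / m = 1 := Nat.div_eq_of_lt_le (by omega) (by omega)
      rw [this, pow_one, hpowb]
  have hdiv : ∀ u : ℕ, u / m + (k + u % m) / m = (k + u) / m := by
    intro u
    conv_rhs => rw [← Nat.mod_add_div u m, ← add_assoc, Nat.add_mul_div_left _ _ hm]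
    ring
  have hfull : ∀ i, i < m →
      G (petitT m i 1) = petitT m (k * i % m) (petitN σ k α i * b ^ (k * i / m)) := by
    intro i
    induction i with
    | zero => intro _; rw [hT0]; simp [petitN]
    | succ i ih =>
      intro hi
      have hlt := Nat.mod_lt (k * i) hm
      rw [hstep i _ _ hi hlt (ih (by omega)), Nat.add_mod_mod, petitN_succ',
        hW _ (by omega), map_mul, map_pow, hpowb, Nat.mul_succ, add_comm (k * i) k, ← hdiv (k * i),
        pow_add]
      congr 1; ring
  have hmain : petitN σ k α m * b ^ k = τ a := by
    obtain ⟨m', rfl⟩ : ∃ m', m = m' + 1 := ⟨m - 1, by omega⟩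
    have h1 : petitMul σ (m' + 1) a (petitT (m' + 1) 1 1) (petitT (m' + 1) m' 1)
        = petitT (m' + 1) 0 a := by
      rw [petitMul_T _ _ _ _ _ (by omega) (by omega), add_comm 1 m']
      simp [petitW]
    have h2 := congrArg G h1
    have hlt := Nat.mod_lt (k * m') hm
    rw [hGmul, hT1, hT0, hfull m' (by omega), petitMul_T _ _ _ _ _ hkm hlt,
      hW _ (by omega), map_mul, map_pow, hpowb, ← mul_assoc, ← petitN_succ', mul_assoc,
      ← pow_add, hdiv, Nat.add_mod_mod, show k + k * m' = k * (m' + 1) by ring,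
      Nat.mul_mod_left, Nat.mul_div_cancel _ hm] at h2
    exact (petitT_inj hm
      (mul_ne_zero (petitN_ne σ k α hα _) (pow_ne_zero _ hb)) h2).2
  have hNm : petitN σ k α m = twistedNorm (⇑σ) n α ^ q := by
    rw [hq, petitN_mul σ n k α hn, petitN_n σ n k (by omega) α hn hcop]
  have hfin : twistedNorm (⇑σ) n α ^ q * b ^ k = τ a := by rw [← hNm, hmain]
  have hτa : σ (τ a) = τ a := by
    rw [← hfin, map_mul, map_pow, map_pow, hσb, twistedNorm_fix σ n α hn]
  have hτa' : ∀ i, (σ ^ i) (τ a) = τ a := by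
    intro i
    induction i with
    | zero => simp
    | succ i ih => rw [petit_pow_add, pow_one, hτa, ih]
  refine ⟨⟨q, hq⟩, ?_, hσb, hcopm, ?_⟩
  · apply τ.injective
    have := hτσ 1 a
    rw [pow_one] at this
    rw [this, hτa']
  · have : m / n = q := by rw [hq, Nat.mul_div_cancel_left _ (by omega)]
    rw [this, hfin]
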